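/- arXiv:2404.12844 — 3 statements merged into one kernel-verified Lean document; each statement's English description precedes it below -/
import Mathlib

section
/- Let L/K be an extension of number fields of odd degree, let Q be a quadratic form in n variables with coefficients in 𝓞_K, and let a ∈ 𝓞_K. If a is represented by Q over 𝓞_L (i.e. a ∈ Q(𝓞_L)), then a is locally represented by Q over 𝓞_K, i.e. for every finite place v of K the element a is represented by Q over the valuation ring 𝓞_v of the completion K_v, and for every archimedean completion K_v of K the element a is represented by Q over K_v. -/
open NumberField MvPolynomial IsDedekindDomain

section

open Matrix

/-- The bilinear form with coefficient matrix `A`, evaluated in an algebra over the coefficients. -/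
def bilinEval {R S ι κ : Type} [CommRing R] [CommRing S] [Algebra R S] [Fintype ι] [Fintype κ]
    (A : Matrix ι κ R) (x : ι → S) (y : κ → S) : S :=
  x ⬝ᵥ (A.map (algebraMap R S) *ᵥ y)

section bilinEval

variable {R S k ι κ μ ν : Type} [CommRing R] [CommRing S] [Algebra R S]
  [Fintype ι] [Fintype κ] [Fintype μ] [Fintype ν]

lemma bilinEval_eq_sum (A : Matrix ι κ R) (x : ι → S) (y : κ → S) :
    bilinEval A x y = ∑ i, ∑ j, algebraMap R S (A i j) * (x i * y j) := by
  simp only [bilinEval, dotProduct, mulVec, Finset.mul_sum, Matrix.map_apply]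
  exact Finset.sum_congr rfl fun i _ => Finset.sum_congr rfl fun j _ => by ring

lemma bilinEval_add_left (A : Matrix ι κ R) (x x' : ι → S) (y : κ → S) :
    bilinEval A (x + x') y = bilinEval A x y + bilinEval A x' y := by
  simp [bilinEval, add_dotProduct]

lemma bilinEval_add_right (A : Matrix ι κ R) (x : ι → S) (y y' : κ → S) :
    bilinEval A x (y + y') = bilinEval A x y + bilinEval A x y' := by
  simp [bilinEval, mulVec_add, dotProduct_add]

lemma bilinEval_smul_left (A : Matrix ι κ R) (c : S) (x : ι → S) (y : κ → S) :
    bilinEval A (c • x) y = c * bilinEval A x y := by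
  simp [bilinEval, smul_dotProduct]

lemma bilinEval_smul_right (A : Matrix ι κ R) (c : S) (x : ι → S) (y : κ → S) :
    bilinEval A x (c • y) = c * bilinEval A x y := by
  simp [bilinEval, mulVec_smul, dotProduct_smul]

lemma bilinEval_smul_smul (A : Matrix ι κ R) (c : S) (x : ι → S) (y : κ → S) :
    bilinEval A (c • x) (c • y) = c ^ 2 * bilinEval A x y := by
  rw [bilinEval_smul_left, bilinEval_smul_right]; ring

lemma bilinEval_matrix_add (A B : Matrix ι κ R) (x : ι → S) (y : κ → S) :
    bilinEval (A + B) x y = bilinEval A x y + bilinEval B x y := by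
  simp [bilinEval, Matrix.map_add, add_mulVec, dotProduct_add]

lemma bilinEval_matrix_smul (c : R) (A : Matrix ι κ R) (x : ι → S) (y : κ → S) :
    bilinEval (c • A) x y = algebraMap R S c * bilinEval A x y := by
  simp [bilinEval_eq_sum, Finset.mul_sum, mul_assoc]

lemma bilinEval_transpose (A : Matrix ι κ R) (x : ι → S) (y : κ → S) :
    bilinEval Aᵀ y x = bilinEval A x y := by
  rw [bilinEval_eq_sum, bilinEval_eq_sum, Finset.sum_comm]
  exact Finset.sum_congr rfl fun i _ => Finset.sum_congr rfl fun j _ => by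
    rw [transpose_apply]; ring

lemma bilinEval_mul_right (A : Matrix ι κ R) (T : Matrix κ ν R) (x : ι → S) (y : ν → S) :
    bilinEval (A * T) x y = bilinEval A x (T.map (algebraMap R S) *ᵥ y) := by
  simp [bilinEval, Matrix.map_mul, mulVec_mulVec]

lemma bilinEval_mul_left (A : Matrix ι κ R) (T : Matrix ι μ R) (x : μ → S) (y : κ → S) :
    bilinEval (Tᵀ * A) x y = bilinEval A (T.map (algebraMap R S) *ᵥ x) y := by
  rw [← bilinEval_transpose A, ← bilinEval_mul_right, ← bilinEval_transpose, transpose_mul,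
    transpose_transpose]

lemma bilinEval_map {S' : Type} [CommRing S'] [Algebra R S'] [Algebra S S'] [IsScalarTower R S S']
    (A : Matrix ι κ R) (x : ι → S) (y : κ → S) :
    algebraMap S S' (bilinEval A x y)
      = bilinEval A (algebraMap S S' ∘ x) (algebraMap S S' ∘ y) := by
  simp [bilinEval_eq_sum, ← IsScalarTower.algebraMap_apply]

lemma bilinEval_single [DecidableEq ι] [DecidableEq κ] (A : Matrix ι κ R) (i : ι) (j : κ) :
    bilinEval A (Pi.single i (1 : S)) (Pi.single j 1) = algebraMap R S (A i j) := by
  simp [bilinEval]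

/-- If every entry of the symmetrization of `A` is divisible by `c`, then the quadratic form of `A`
is `c` times a quadratic form. -/
lemma exists_bilinEval_self_eq_mul (A : Matrix ι ι R) (c : R)
    (hdiag : ∀ i, c ∣ A i i) (hoff : ∀ i j, c ∣ A i j + A j i) :
    ∃ B : Matrix ι ι R, ∀ (S : Type) [CommRing S] [Algebra R S] (x : ι → S),
      bilinEval A x x = algebraMap R S c * bilinEval B x x := by
  classical
  choose d hd using hdiag
  choose f hf using hoff
  obtain ⟨lin⟩ : Nonempty (LinearOrder ι) := ⟨LinearOrder.lift' (Fintype.equivFin ι)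
    (Fintype.equivFin ι).injective⟩
  let B : Matrix ι ι R := fun i j => if i < j then f i j else if i = j then d i else 0
  refine ⟨B, fun S _ _ x => ?_⟩
  rw [← bilinEval_matrix_smul, ← sub_eq_zero]
  have key : ∀ i j, A i j - c * B i j + (A j i - c * B j i) = 0 := by
    intro i j
    rcases lt_trichotomy i j with h | h | h
    · simp only [B, h, if_true, not_lt_of_gt h, h.ne', if_false]
      linear_combination hf i j
    · subst h
      simp only [B, lt_irrefl, if_true, if_false]
      linear_combination 2 * hd i
    · simp only [B, h, if_true, not_lt_of_gt h, h.ne', if_false]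
      linear_combination hf j i
  have key0 : ∀ i, A i i - c * B i i = 0 := by
    intro i
    simp only [B, lt_irrefl, if_true, if_false]
    linear_combination hd i
  rw [bilinEval_eq_sum, bilinEval_eq_sum, ← Finset.sum_product', ← Finset.sum_product',
    ← Finset.sum_sub_distrib]
  refine Finset.sum_involution (fun p _ => (p.2, p.1)) ?_ ?_ ?_ ?_
  · rintro ⟨i, j⟩ -
    have := congrArg (algebraMap R S) (key i j)
    simp only [map_add, map_sub, map_mul, map_zero] at this
    simp only [Matrix.smul_apply, smul_eq_mul, map_mul]
    linear_combination (x i * x j) * this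
  · rintro ⟨i, j⟩ - h h'
    obtain rfl : j = i := congrArg Prod.fst h'
    have := congrArg (algebraMap R S) (key0 j)
    simp only [map_sub, map_mul, map_zero] at this
    apply h
    simp only [Matrix.smul_apply, smul_eq_mul, map_mul]
    linear_combination (x j * x j) * this
  · simp
  · simp

end bilinEval

/-- The quadratic form `x ↦ A(x, x)` has no nonzero zero over the field `k`. -/
def IsAnisotropicOver {R ι : Type} [CommRing R] [Fintype ι] (k : Type) [Field k] [Algebra R k]
    (A : Matrix ι ι R) : Prop :=
  ∀ x : ι → k, bilinEval A x x = 0 → x = 0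

section FiniteField

variable {R k k' ι : Type} [CommRing R] [Field k] [Algebra R k] [Fintype ι]

lemma IsAnisotropicOver.card_le_two [Finite k] {A : Matrix ι ι R} (h : IsAnisotropicOver k A) :
    Fintype.card ι ≤ 2 := by
  classical
  have := Fintype.ofFinite k
  by_contra! hcard
  let f : MvPolynomial ι k := ∑ i, ∑ j,
    MvPolynomial.C (algebraMap R k (A i j)) * (MvPolynomial.X i * MvPolynomial.X j)
  have hdeg : f.totalDegree < Fintype.card ι := by
    refine lt_of_le_of_lt ?_ hcard
    refine (MvPolynomial.totalDegree_finsetSum_le fun i _ =>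
      MvPolynomial.totalDegree_finsetSum_le fun j _ => ?_)
    refine (MvPolynomial.totalDegree_mul _ _).trans ?_
    rw [MvPolynomial.totalDegree_C, zero_add]
    refine (MvPolynomial.totalDegree_mul _ _).trans ?_
    simp
  have heval : ∀ x : ι → k, MvPolynomial.eval x f = bilinEval A x x := fun x => by
    simp [f, bilinEval_eq_sum]
  obtain ⟨p, hp⟩ := CharP.exists k
  have hdvd := char_dvd_card_solutions p hdeg
  have hone : Fintype.card { x : ι → k // MvPolynomial.eval x f = 0 } = 1 := by
    rw [Fintype.card_eq_one_iff]
    refine ⟨⟨0, by rw [heval]; simp [bilinEval]⟩, fun y => Subtype.ext (h _ ?_)⟩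
    rw [← heval]
    exact y.2
  rw [hone, Nat.dvd_one] at hdvd
  exact CharP.char_ne_one k p hdvd

/-- Springer's theorem for finite fields. -/
lemma IsAnisotropicOver.of_odd_finrank [Finite k] [Field k'] [Algebra R k'] [Algebra k k']
    [IsScalarTower R k k'] (hodd : Odd (Module.finrank k k')) {A : Matrix ι ι R}
    (h : IsAnisotropicOver k A) : IsAnisotropicOver k' A := by
  classical
  have : FiniteDimensional k k' := Module.finite_of_finrank_pos hodd.pos
  have hdiag : ∀ i, algebraMap R k (A i i) ≠ 0 := by
    intro i hi
    have := h (Pi.single i 1) (by rw [bilinEval_single, hi])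
    simpa using congrFun this i
  intro x hx
  by_contra hne
  obtain ⟨i, hi⟩ := Function.ne_iff.mp hne
  rw [Pi.zero_apply] at hi
  set z : ι → k' := (x i)⁻¹ • x with hz
  have hzi : z i = 1 := by simp [hz, hi]
  have hz0 : bilinEval A z z = 0 := by rw [hz, bilinEval_smul_smul, hx, mul_zero]
  obtain ⟨j, hj⟩ : ∃ j, Finset.univ.erase i ⊆ {j} := by
    have : Nonempty ι := ⟨i⟩
    refine Finset.card_le_one_iff_subset_singleton.mp ?_
    rw [Finset.card_erase_of_mem (Finset.mem_univ i), Finset.card_univ]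
    have := h.card_le_two
    omega
  have hcover : ∀ l, l = i ∨ l = j := by
    intro l
    by_contra! hl
    exact hl.2 (Finset.mem_singleton.mp (hj (Finset.mem_erase.mpr ⟨hl.1, Finset.mem_univ l⟩)))
  have hzj : z j ∈ (algebraMap k k').range := by
    rcases eq_or_ne i j with rfl | hij
    · exact ⟨1, by rw [hzi, map_one]⟩
    have huniv : (Finset.univ : Finset ι) = {i, j} := by
      ext l
      simpa using hcover l
    have hquad : algebraMap R k' (A j j) * z j ^ 2
        + algebraMap R k' (A i j + A j i) * z j + algebraMap R k' (A i i) = 0 := by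
      rw [bilinEval_eq_sum, huniv, Finset.sum_pair hij, Finset.sum_pair hij,
        Finset.sum_pair hij, hzi] at hz0
      rw [map_add]
      linear_combination hz0
    let f : Polynomial k := Polynomial.C (algebraMap R k (A j j)) * Polynomial.X ^ 2
      + Polynomial.C (algebraMap R k (A i j + A j i)) * Polynomial.X
      + Polynomial.C (algebraMap R k (A i i))
    have hf0 : f ≠ 0 := by
      intro hf
      have := congrArg (fun g => Polynomial.coeff g 2) hf
      simp only [f, Polynomial.coeff_add, Polynomial.coeff_C_mul, Polynomial.coeff_X_pow,
        Polynomial.coeff_X, Polynomial.coeff_C] at this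
      norm_num at this
      exact hdiag j this
    have hdvd : minpoly k (z j) ∣ f := minpoly.dvd k _ (by
      simpa [f, ← IsScalarTower.algebraMap_apply] using hquad)
    have hzint : IsIntegral k (z j) := Algebra.IsIntegral.isIntegral _
    have hle : (minpoly k (z j)).natDegree ≤ 2 :=
      (Polynomial.natDegree_le_of_dvd hdvd hf0).trans Polynomial.natDegree_quadratic_le
    have hoddmin : Odd (minpoly k (z j)).natDegree :=
      Odd.of_dvd_nat hodd (minpoly.degree_dvd hzint)
    rw [← minpoly.natDegree_eq_one_iff]
    obtain ⟨c, hc⟩ := hoddmin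
    omega
  have hrange : ∀ l, ∃ c, algebraMap k k' c = z l := by
    intro l
    rcases hcover l with rfl | rfl
    · exact ⟨1, by rw [hzi, map_one]⟩
    · exact hzj
  choose y hy using hrange
  have hyz : algebraMap k k' ∘ y = z := funext hy
  have hy0 : bilinEval A y y = 0 := by
    apply (algebraMap k k').injective
    rw [bilinEval_map, hyz, hz0, map_zero]
  have := hy i
  rw [h y hy0, Pi.zero_apply, map_zero, hzi] at this
  exact zero_ne_one this

end FiniteField

section Decomposition

variable {R k κ : Type} [CommRing R] [Field k] [Algebra R k] [Fintype κ] [DecidableEq κ]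

/-- If every zero over the residue field `k` of a quadratic form is singular, then modulo `π`
the form is the pullback of an anisotropic form. -/
lemma exists_anisotropic_decomposition (π : R) (hsurj : Function.Surjective (algebraMap R k))
    (hker : ∀ x, algebraMap R k x = 0 ↔ π ∣ x) (A : Matrix κ κ R)
    (hsing : ∀ w : κ → k, bilinEval A w w = 0 → ∀ v, bilinEval A w v + bilinEval A v w = 0) :
    ∃ (ι : Type) (_ : Fintype ι) (T : Matrix κ ι R) (C : Matrix ι κ R) (q : Matrix ι ι R)
      (b : Matrix ι κ R) (q' : Matrix κ κ R), IsAnisotropicOver k q ∧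
      ∀ (S : Type) [CommRing S] [Algebra R S] (x : ι → S) (y : κ → S),
        bilinEval A (T.map (algebraMap R S) *ᵥ x + (1 - T * C).map (algebraMap R S) *ᵥ y)
            (T.map (algebraMap R S) *ᵥ x + (1 - T * C).map (algebraMap R S) *ᵥ y)
          = bilinEval q x x + algebraMap R S π * (bilinEval b x y + bilinEval q' y y) := by
  have hzero_add : ∀ {w v : κ → k}, bilinEval A w w = 0 → bilinEval A v v = 0 →
      bilinEval A (w + v) (w + v) = 0 := by
    intro w v hw hv
    rw [bilinEval_add_left, bilinEval_add_right, bilinEval_add_right]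
    linear_combination hw + hv + hsing w hw v
  let W : Submodule k (κ → k) :=
    { carrier := {w | bilinEval A w w = 0}
      add_mem' := hzero_add
      zero_mem' := by simp [bilinEval]
      smul_mem' := fun c w (hw : bilinEval A w w = 0) => by
        change bilinEval A (c • w) (c • w) = 0
        rw [bilinEval_smul_smul, hw, mul_zero] }
  have hW : ∀ w, w ∈ W ↔ bilinEval A w w = 0 := fun w => Iff.rfl
  obtain ⟨ι, a, ha, hspan, hli⟩ := exists_linearIndependent' k
    (fun j : κ => W.mkQ (Pi.single j (1 : k)))
  have : Finite ι := Finite.of_injective a ha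
  have := Fintype.ofFinite ι
  classical
  have hmem : ∀ j, ∃ c : ι → k, ∑ i, c i • W.mkQ (Pi.single (a i) (1 : k))
      = W.mkQ (Pi.single j (1 : k)) := by
    intro j
    have : W.mkQ (Pi.single j (1 : k)) ∈ Submodule.span k
        (Set.range ((fun j : κ => W.mkQ (Pi.single j (1 : k))) ∘ a)) := by
      rw [hspan]
      exact Submodule.subset_span ⟨j, rfl⟩
    exact (Submodule.mem_span_range_iff_exists_fun k).mp this
  choose c hc using hmem
  choose C₀ hC using fun (i : ι) (j : κ) => hsurj (c j i)
  let C : Matrix ι κ R := Matrix.of C₀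
  let T : Matrix κ ι R := (1 : Matrix κ κ R).submatrix id a
  have hT : ∀ x : ι → k, T.map (algebraMap R k) *ᵥ x = ∑ i, x i • Pi.single (a i) (1 : k) := by
    intro x
    ext j
    simp [T, mulVec, dotProduct, Matrix.one_apply, Pi.single_apply, Finset.sum_apply, mul_comm]
  let U : Matrix κ κ R := 1 - T * C
  have hU : ∀ j, U.map (algebraMap R k) *ᵥ Pi.single j 1 ∈ W := by
    intro j
    have : U.map (algebraMap R k) *ᵥ Pi.single j 1 = Pi.single j (1 : k)
        - ∑ i, c j i • Pi.single (a i) (1 : k) := by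
      have h1 : U.map (algebraMap R k)
          = 1 - T.map (algebraMap R k) * (Matrix.map C (algebraMap R k)) := by
        have := map_sub (algebraMap R k).mapMatrix (1 : Matrix κ κ R) (T * C)
        rw [map_one] at this
        simpa [Matrix.map_mul] using this
      rw [h1, sub_mulVec, one_mulVec, ← mulVec_mulVec, hT]
      congr 1
      refine Finset.sum_congr rfl fun i _ => ?_
      simp [C, hC]
    rw [this, ← Submodule.ker_mkQ W, LinearMap.mem_ker, map_sub, map_sum, sub_eq_zero]
    simpa using (hc j).symm
  have hcross : ∀ i j, π ∣ (Tᵀ * A * U + (Uᵀ * A * T)ᵀ) i j := by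
    intro i j
    rw [← hker, ← bilinEval_single (S := k), bilinEval_matrix_add, bilinEval_transpose,
      bilinEval_mul_right, bilinEval_mul_left, bilinEval_mul_right, bilinEval_mul_left, add_comm]
    exact hsing _ (hU j) _
  choose b hb using hcross
  obtain ⟨q', hq'⟩ := exists_bilinEval_self_eq_mul (Uᵀ * A * U) π
    (fun i => by
      rw [← hker, ← bilinEval_single (S := k), bilinEval_mul_right, bilinEval_mul_left]
      exact hU i)
    (fun i j => by
      rw [← hker, map_add, ← bilinEval_single (S := k), ← bilinEval_single (S := k),
        bilinEval_mul_right, bilinEval_mul_left, bilinEval_mul_right, bilinEval_mul_left]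
      exact hsing _ (hU i) _)
  refine ⟨ι, inferInstance, T, C, Tᵀ * A * T, b, q', ?_, ?_⟩
  · intro x hx
    rw [bilinEval_mul_right, bilinEval_mul_left, ← hW, hT, ← Submodule.ker_mkQ W,
      LinearMap.mem_ker, map_sum] at hx
    refine funext fun i => Fintype.linearIndependent_iff.mp hli x ?_ i
    simpa using hx
  · intro S _ _ x y
    have hb' : Tᵀ * A * U + (Uᵀ * A * T)ᵀ = π • (Matrix.of b) := by
      ext i j
      simpa using hb i j
    have h2 : bilinEval A (T.map (algebraMap R S) *ᵥ x) (U.map (algebraMap R S) *ᵥ y)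
        + bilinEval A (U.map (algebraMap R S) *ᵥ y) (T.map (algebraMap R S) *ᵥ x)
        = algebraMap R S π * bilinEval b x y := by
      change _ = algebraMap R S π * bilinEval (Matrix.of b) x y
      rw [← bilinEval_matrix_smul, ← hb', bilinEval_matrix_add, bilinEval_transpose,
        bilinEval_mul_right, bilinEval_mul_left, bilinEval_mul_right, bilinEval_mul_left]
    have h3 := hq' S y
    rw [bilinEval_mul_right, bilinEval_mul_left] at h3 ⊢
    rw [bilinEval_add_left, bilinEval_add_right, bilinEval_add_right]
    change bilinEval A _ _ + bilinEval A _ (U.map (algebraMap R S) *ᵥ y)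
      + (bilinEval A (U.map (algebraMap R S) *ᵥ y) _
        + bilinEval A (U.map (algebraMap R S) *ᵥ y) (U.map (algebraMap R S) *ᵥ y)) = _
    linear_combination h2 + h3

end Decomposition

section Lifting

variable {R S k k' ι κ : Type} [CommRing R] [CommRing S] [Field k] [Field k']
  [Algebra R S] [Algebra R k] [Algebra R k'] [Algebra S k'] [IsScalarTower R S k']
  [Fintype ι] [Fintype κ]

lemma bilinEval_fromCols {μ : Type} [Fintype μ] (A : Matrix ι κ R) (B : Matrix ι μ R)
    (x : ι → S) (y : κ → S) (z : μ → S) :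
    bilinEval (fromCols A B) x (Sum.elim y z) = bilinEval A x y + bilinEval B x z := by
  simp [bilinEval_eq_sum, Finset.sum_add_distrib]

lemma bilinEval_fromBlocks (A : Matrix ι ι R) (B : Matrix ι κ R) (C : Matrix κ ι R)
    (D : Matrix κ κ R) (x : ι → S) (y : κ → S) :
    bilinEval (fromBlocks A B C D) (Sum.elim x y) (Sum.elim x y)
      = bilinEval A x x + bilinEval B x y + bilinEval C y x + bilinEval D y y := by
  simp [bilinEval_eq_sum, Finset.sum_add_distrib]
  ring

/-- An anisotropic form over the residue field detects divisibility of vectors. -/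
lemma exists_eq_pow_smul_of_pow_dvd_bilinEval [IsDomain S] {ϖ : S} (hϖ : ϖ ≠ 0)
    (hker : ∀ x : S, algebraMap S k' x = 0 ↔ ϖ ∣ x) {q : Matrix ι ι R}
    (hq : IsAnisotropicOver k' q) (i : ℕ) (u : ι → S)
    (hu : ϖ ^ (2 * i + 1) ∣ bilinEval q u u) : ∃ u' : ι → S, u = ϖ ^ (i + 1) • u' := by
  have base : ∀ u : ι → S, ϖ ∣ bilinEval q u u → ∃ u' : ι → S, u = ϖ • u' := by
    intro u hu
    rw [← hker, bilinEval_map] at hu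
    have h0 := hq _ hu
    have : ∀ j, ϖ ∣ u j := fun j => (hker _).mp (congrFun h0 j)
    choose u' hu' using this
    exact ⟨u', funext hu'⟩
  induction i generalizing u with
  | zero => simpa using base u (by simpa using hu)
  | succ i ih =>
    obtain ⟨u₁, rfl⟩ := ih u ((pow_dvd_pow ϖ (by omega)).trans hu)
    rw [bilinEval_smul_smul, ← pow_mul,
      show 2 * (i + 1) + 1 = (i + 1) * 2 + 1 by ring, pow_succ] at hu
    obtain ⟨u₂, rfl⟩ := base u₁ ((mul_dvd_mul_iff_left (pow_ne_zero _ hϖ)).mp hu)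
    exact ⟨u₂, by rw [smul_smul, ← pow_succ]⟩

/-- Hensel's lemma for a nonsingular zero of a quadratic form. -/
lemma exists_lift_pow_dvd_bilinEval {π : R} (hsurj : Function.Surjective (algebraMap R k))
    (hker : ∀ x, algebraMap R k x = 0 ↔ π ∣ x) (A : Matrix κ κ R) {w v : κ → k}
    (hw : bilinEval A w w = 0) (hv : bilinEval A w v + bilinEval A v w ≠ 0) (m : ℕ) :
    ∃ x : κ → R, algebraMap R k ∘ x = w ∧ π ^ (m + 1) ∣ bilinEval A x x := by
  obtain ⟨v, rfl⟩ : ∃ v' : κ → R, algebraMap R k ∘ v' = v := by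
    choose v' hv' using fun i => hsurj (v i)
    exact ⟨v', funext hv'⟩
  induction m with
  | zero =>
    choose x hx using fun i => hsurj (w i)
    have hx : algebraMap R k ∘ x = w := funext hx
    exact ⟨x, hx, by rw [pow_one, ← hker, bilinEval_map, hx, hw]⟩
  | succ m ih =>
    obtain ⟨x, rfl, r, hr⟩ := ih
    rw [← bilinEval_map, ← bilinEval_map, ← map_add] at hv
    obtain ⟨s, hs⟩ := hsurj (-algebraMap R k r / algebraMap R k (bilinEval A x v + bilinEval A v x))
    have hdvd : π ∣ r + s * (bilinEval A x v + bilinEval A v x) := by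
      rw [← hker, map_add, map_mul, hs, div_mul_cancel₀ _ hv, add_neg_cancel]
    obtain ⟨t, ht⟩ := hdvd
    refine ⟨x + (π ^ (m + 1) * s) • v, ?_, ?_⟩
    · have h0 : algebraMap R k π = 0 := (hker π).mpr dvd_rfl
      ext i
      simp [h0]
    · refine ⟨t + π ^ m * s ^ 2 * bilinEval A v v, ?_⟩
      rw [bilinEval_add_left, bilinEval_add_right, bilinEval_add_right, bilinEval_smul_smul,
        bilinEval_smul_left, bilinEval_smul_right]
      linear_combination hr + π ^ (m + 1) * ht

/-- A quadratic form with a nonsingular zero has one off any given hyperplane. -/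
lemma exists_nonsingular_zero_dotProduct_ne_zero (A : Matrix κ κ R) {y w v : κ → k} (hy : y ≠ 0)
    (hw : bilinEval A w w = 0) (hv : bilinEval A w v + bilinEval A v w ≠ 0) :
    ∃ w' v' : κ → k, bilinEval A w' w' = 0 ∧ bilinEval A w' v' + bilinEval A v' w' ≠ 0 ∧
      y ⬝ᵥ w' ≠ 0 := by
  classical
  by_cases hyw : y ⬝ᵥ w = 0
  swap
  · exact ⟨w, v, hw, hv, hyw⟩
  obtain ⟨v, hv, hyv⟩ : ∃ v : κ → k, bilinEval A w v + bilinEval A v w ≠ 0 ∧ y ⬝ᵥ v ≠ 0 := by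
    by_contra! h
    obtain ⟨i, hi⟩ := Function.ne_iff.mp hy
    have hyv := h v hv
    have hyi : y ⬝ᵥ (Pi.single i 1 : κ → k) ≠ 0 := by simpa using hi
    have hBi : bilinEval A w (Pi.single i 1) + bilinEval A (Pi.single i 1) w = 0 := by
      by_contra hne
      exact hyi (h _ hne)
    have h3 := h (v + Pi.single i 1) (by
      rw [bilinEval_add_left, bilinEval_add_right]
      intro h0
      exact hv (by linear_combination h0 - hBi))
    rw [dotProduct_add, hyv, zero_add] at h3
    exact hyi h3
  set B := bilinEval A w v + bilinEval A v w with hB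
  refine ⟨v + (-bilinEval A v v / B) • w, w, ?_, ?_, ?_⟩
  · rw [bilinEval_add_left, bilinEval_add_right, bilinEval_add_right, bilinEval_smul_smul,
      bilinEval_smul_left, bilinEval_smul_right, hw]
    have : -bilinEval A v v / B * B = -bilinEval A v v := div_mul_cancel₀ _ hv
    linear_combination this + (bilinEval A v v / B) * hB - (bilinEval A v v / B) * hB
  · rw [bilinEval_add_left, bilinEval_add_right, bilinEval_smul_left, bilinEval_smul_right, hw]
    intro h0
    exact hv (by linear_combination hB + h0)
  · rw [dotProduct_add, dotProduct_smul, hyw]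
    simpa using hyv

end Lifting

section Descent

variable {R S k k' : Type} [CommRing R] [CommRing S] [IsDomain S] [Field k] [Field k']
  [Algebra R S] [Algebra R k] [Algebra R k'] [Algebra S k'] [Algebra k k']
  [IsScalarTower R S k'] [IsScalarTower R k k']

/-- In an extension of discrete valuation rings of odd ramification index `2 g + 1`, if `q(u)` is
cancelled modulo `π` by `q₁(x)` with `q` and `q₁` anisotropic, then `u` is divisible by `π`. -/
lemma exists_eq_smul_of_bilinEval_add_eq_zero {ι ι₁ κ : Type} [Fintype ι] [Fintype ι₁] [Fintype κ]
    {π : R} {ϖ : S} (hϖ : ϖ ≠ 0) (hker' : ∀ x : S, algebraMap S k' x = 0 ↔ ϖ ∣ x)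
    {g : ℕ} {ε : Sˣ} (hπ : algebraMap R S π = ε * ϖ ^ (2 * g + 1))
    {q : Matrix ι ι R} {q₁ : Matrix ι₁ ι₁ R} (hq : IsAnisotropicOver k' q)
    (hq₁ : IsAnisotropicOver k' q₁) (b : Matrix ι κ R) {u : ι → S} {x : ι₁ → S} {w : κ → S}
    {r : S} (h : bilinEval q u u + algebraMap R S π * (bilinEval b u w +
      (bilinEval q₁ x x + algebraMap R S π * r)) = 0) :
    ∃ u' : ι → S, u = algebraMap R S π • u' := by
  have hclaim : ∀ d ≤ g, ∃ u' : ι → S, u = ϖ ^ (g + 1 + d) • u' := by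
    intro d hd
    induction d with
    | zero =>
      refine exists_eq_pow_smul_of_pow_dvd_bilinEval hϖ hker' hq g u ?_
      rw [eq_neg_of_add_eq_zero_left h, hπ]
      exact (Dvd.intro_left _ rfl |>.mul_right _).neg_right
    | succ d ih =>
      obtain ⟨u', rfl⟩ := ih (by omega)
      obtain ⟨c, rfl⟩ : ∃ c, g = d + 1 + c := Nat.exists_eq_add_of_le hd
      rw [bilinEval_smul_smul, bilinEval_smul_left, hπ] at h
      have h1 : ϖ ^ (2 * d + 1) * bilinEval q u' u' + ε * (bilinEval q₁ x x +
          ϖ ^ (2 * d + 2) * (ϖ ^ c * bilinEval b u' w + ε * ϖ ^ (2 * c + 1) * r)) = 0 := by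
        apply (mul_right_injective₀ (pow_ne_zero (2 * (d + 1 + c) + 1) hϖ))
        dsimp only
        rw [mul_zero, ← h]
        ring
      have h2 : bilinEval q₁ x x = -(ϖ ^ (2 * d + 1) * (↑ε⁻¹ * bilinEval q u' u' +
          ϖ * (ϖ ^ c * bilinEval b u' w + ε * ϖ ^ (2 * c + 1) * r))) := by
        have := congrArg (fun z => (↑ε⁻¹ : S) * z) h1
        rw [mul_add, ← mul_assoc (↑ε⁻¹ : S) ↑ε, Units.inv_mul] at this
        linear_combination this
      obtain ⟨x', rfl⟩ := exists_eq_pow_smul_of_pow_dvd_bilinEval hϖ hker' hq₁ d x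
        (by rw [h2]; exact (Dvd.intro _ rfl).neg_right)
      rw [bilinEval_smul_smul] at h1
      have h3 : ϖ ∣ bilinEval q u' u' := by
        rw [← mul_dvd_mul_iff_left (pow_ne_zero (2 * d + 1) hϖ)]
        refine ⟨-(ε * (bilinEval q₁ x' x' +
          (ϖ ^ c * bilinEval b u' w + ε * ϖ ^ (2 * c + 1) * r))), ?_⟩
        linear_combination h1
      obtain ⟨u'', rfl⟩ := exists_eq_pow_smul_of_pow_dvd_bilinEval hϖ hker' hq 0 u'
        (by simpa using h3)
      exact ⟨u'', by rw [smul_smul, ← pow_add]; congr 2⟩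
  obtain ⟨u', rfl⟩ := hclaim g le_rfl
  refine ⟨(↑ε⁻¹ : S) • u', ?_⟩
  rw [smul_smul, hπ]
  congr 1
  rw [mul_right_comm, Units.mul_inv, one_mul]
  ring

/-- Descent of approximate zeros along an extension of discrete valuation rings with odd
ramification index and odd residue degree. -/
lemma exists_pow_dvd_of_bilinEval_add_eq_zero [Finite k] (hodd : Odd (Module.finrank k k'))
    {π : R} {ϖ : S} (hϖ : ϖ ≠ 0) (hsurj : Function.Surjective (algebraMap R k))
    (hker : ∀ x, algebraMap R k x = 0 ↔ π ∣ x)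
    (hker' : ∀ x : S, algebraMap S k' x = 0 ↔ ϖ ∣ x)
    {g : ℕ} {ε : Sˣ} (hπ : algebraMap R S π = ε * ϖ ^ (2 * g + 1)) (m : ℕ)
    {ι κ : Type} [Fintype ι] [Fintype κ] {q : Matrix ι ι R} (hq : IsAnisotropicOver k q)
    (b : Matrix ι κ R) (q' : Matrix κ κ R) (y : κ → R) {u : ι → S} {w : κ → S}
    (h : bilinEval q u u + algebraMap R S π * (bilinEval b u w + bilinEval q' w w) = 0)
    (hy : algebraMap S k' ((algebraMap R S ∘ y) ⬝ᵥ w) ≠ 0) :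
    ∃ (u₀ : ι → R) (w₀ : κ → R),
      π ^ m ∣ π * bilinEval q u₀ u₀ + π * bilinEval b u₀ w₀ + bilinEval q' w₀ w₀ ∧
      algebraMap R k (y ⬝ᵥ w₀) ≠ 0 := by
  classical
  have hπ0 : algebraMap R S π ≠ 0 := by
    rw [hπ]; exact mul_ne_zero ε.ne_zero (pow_ne_zero _ hϖ)
  have hy0 : algebraMap R k ∘ y ≠ 0 := by
    intro h0
    apply hy
    rw [dotProduct, map_sum]
    refine Finset.sum_eq_zero fun i _ => ?_
    have := congrFun h0 i
    rw [Function.comp_apply, Pi.zero_apply] at this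
    rw [map_mul, Function.comp_apply, ← IsScalarTower.algebraMap_apply,
      IsScalarTower.algebraMap_apply R k k', this, map_zero, zero_mul]
  have hdot : ∀ w₀ : κ → R, algebraMap R k (y ⬝ᵥ w₀) = (algebraMap R k ∘ y) ⬝ᵥ (algebraMap R k ∘ w₀) := by
    intro w₀
    simp [dotProduct]
  induction m generalizing ι κ with
  | zero =>
    obtain ⟨i, hi⟩ := Function.ne_iff.mp hy0
    exact ⟨0, Pi.single i 1, by simp, by simpa using hi⟩
  | succ m ih =>
  by_cases hsing : ∀ w : κ → k, bilinEval q' w w = 0 →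
      ∀ v, bilinEval q' w v + bilinEval q' v w = 0
  swap
  · push Not at hsing
    obtain ⟨w₁, hw₁, v₁, hv₁⟩ := hsing
    obtain ⟨w₂, v₂, hw₂, hv₂, hyw₂⟩ :=
      exists_nonsingular_zero_dotProduct_ne_zero q' hy0 hw₁ hv₁
    obtain ⟨w₀, rfl, hdvd⟩ := exists_lift_pow_dvd_bilinEval hsurj hker q' hw₂ hv₂ m
    refine ⟨0, w₀, by simpa [bilinEval] using hdvd, ?_⟩
    rwa [hdot]
  obtain ⟨ι₁, _, T, C, q₁, b₁, q₂, hq₁, hdec⟩ :=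
    exists_anisotropic_decomposition π hsurj hker q' hsing
  set U : Matrix κ κ R := 1 - T * C with hU
  have hw : T.map (algebraMap R S) *ᵥ (C.map (algebraMap R S) *ᵥ w)
      + U.map (algebraMap R S) *ᵥ w = w := by
    have : U.map (algebraMap R S) = 1 - T.map (algebraMap R S) * (C.map (algebraMap R S)) := by
      have := map_sub (algebraMap R S).mapMatrix (1 : Matrix κ κ R) (T * C)
      rw [map_one] at this
      simpa [Matrix.map_mul] using this
    rw [this, sub_mulVec, one_mulVec, mulVec_mulVec, add_sub_cancel]
  set x : ι₁ → S := C.map (algebraMap R S) *ᵥ w with hx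
  have hq'w := hdec S x w
  rw [hw] at hq'w
  have h' := h
  rw [hq'w] at h'
  obtain ⟨u', rfl⟩ := exists_eq_smul_of_bilinEval_add_eq_zero hϖ hker' hπ
    (hq.of_odd_finrank (k' := k') hodd) (hq₁.of_odd_finrank (k' := k') hodd) b h'
  have hbw : bilinEval b u' w = bilinEval (b * T)ᵀ x u' + bilinEval (b * U) u' w := by
    rw [bilinEval_transpose, bilinEval_mul_right, bilinEval_mul_right, ← bilinEval_add_right, hw]
  have hmain : bilinEval q₁ x x + algebraMap R S π *
      (bilinEval (fromCols (b * T)ᵀ b₁) x (Sum.elim u' w) +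
        bilinEval (fromBlocks q (b * U) 0 q₂) (Sum.elim u' w) (Sum.elim u' w)) = 0 := by
    rw [bilinEval_smul_smul, bilinEval_smul_left] at h'
    rw [bilinEval_fromCols, bilinEval_fromBlocks]
    apply mul_right_injective₀ hπ0
    dsimp only
    have h0 : bilinEval (0 : Matrix κ ι R) w u' = 0 := by simp [bilinEval]
    rw [h0, mul_zero]
    linear_combination h' - (algebraMap R S π) ^ 2 * hbw
  have hx0 : ∃ x' : ι₁ → S, x = ϖ • x' := by
    have := exists_eq_pow_smul_of_pow_dvd_bilinEval hϖ hker'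
      (hq₁.of_odd_finrank (k' := k') hodd) 0 x (by
        rw [eq_neg_of_add_eq_zero_left hmain, hπ]
        exact (((pow_dvd_pow ϖ (by omega)).mul_left _).mul_right _).neg_right)
    simpa using this
  obtain ⟨x', hx'⟩ := hx0
  have hϖ0 : algebraMap S k' ϖ = 0 := (hker' ϖ).mpr dvd_rfl
  have hy' : algebraMap S k' ((algebraMap R S ∘ Sum.elim (0 : ι → R) (y ᵥ* U)) ⬝ᵥ
      Sum.elim u' w) ≠ 0 := by
    have h1 : (algebraMap R S ∘ Sum.elim (0 : ι → R) (y ᵥ* U)) ⬝ᵥ Sum.elim u' w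
        = (algebraMap R S ∘ y) ⬝ᵥ (U.map (algebraMap R S) *ᵥ w) := by
      have h2 : algebraMap R S ∘ (y ᵥ* U) = (algebraMap R S ∘ y) ᵥ* U.map (algebraMap R S) := by
        ext i
        exact RingHom.map_vecMul _ _ _ _
      rw [dotProduct_mulVec, ← h2]
      simp [dotProduct]
    rw [h1]
    rw [← hw, dotProduct_add, map_add, hx', mulVec_smul, dotProduct_smul, smul_eq_mul, map_mul,
      hϖ0, zero_mul, zero_add] at hy
    exact hy
  have hy0' : algebraMap R k ∘ Sum.elim (0 : ι → R) (y ᵥ* U) ≠ 0 := by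
    intro h0
    apply hy'
    rw [dotProduct, map_sum]
    refine Finset.sum_eq_zero fun i _ => ?_
    have := congrFun h0 i
    rw [Function.comp_apply, Pi.zero_apply] at this
    rw [map_mul, Function.comp_apply, ← IsScalarTower.algebraMap_apply,
      IsScalarTower.algebraMap_apply R k k', this, map_zero, zero_mul]
  obtain ⟨x₀, z₀, hdvd, hz₀⟩ := ih hq₁ (fromCols (b * T)ᵀ b₁) (fromBlocks q (b * U) 0 q₂)
    (Sum.elim 0 (y ᵥ* U)) hmain hy' hy0' (fun w₀ => by simp [dotProduct])
  obtain ⟨u₀, w₂, rfl⟩ : ∃ u₀ w₂, z₀ = Sum.elim u₀ w₂ :=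
    ⟨z₀ ∘ Sum.inl, z₀ ∘ Sum.inr, (Sum.elim_comp_inl_inr z₀).symm⟩
  have hmapT : T.map (algebraMap R R) = T := by ext; rfl
  have hmapU : U.map (algebraMap R R) = U := by ext; rfl
  refine ⟨u₀, T *ᵥ (π • x₀) + U *ᵥ w₂, ?_, ?_⟩
  · have hd := hdec R (π • x₀) w₂
    rw [hmapT, hmapU] at hd
    rw [hd, bilinEval_smul_smul, bilinEval_smul_left]
    rw [bilinEval_fromCols, bilinEval_fromBlocks, bilinEval_transpose, bilinEval_mul_right,
      bilinEval_mul_right, hmapT, hmapU] at hdvd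
    have h0 : bilinEval (0 : Matrix κ ι R) w₂ u₀ = 0 := by simp [bilinEval]
    obtain ⟨t, ht⟩ := hdvd
    refine ⟨t, ?_⟩
    rw [bilinEval_add_right, mulVec_smul, bilinEval_smul_right, Algebra.algebraMap_self,
      RingHom.id_apply]
    rw [h0] at ht
    linear_combination π * ht
  · have h1 : Sum.elim (0 : ι → R) (y ᵥ* U) ⬝ᵥ Sum.elim u₀ w₂ = y ⬝ᵥ (U *ᵥ w₂) := by
      rw [dotProduct_mulVec]
      simp [dotProduct]
    have hπk : algebraMap R k π = 0 := (hker π).mpr dvd_rfl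
    rw [h1] at hz₀
    rwa [dotProduct_add, map_add, mulVec_smul, dotProduct_smul, smul_eq_mul, map_mul, hπk,
      zero_mul, zero_add]

/-- Approximate integral representations descend along an extension of discrete valuation rings
with odd ramification index and odd residue degree. -/
lemma exists_pow_dvd_bilinEval_sub [Finite k] (hodd : Odd (Module.finrank k k'))
    {π : R} {ϖ : S} (hϖ : ϖ ≠ 0) (hsurj : Function.Surjective (algebraMap R k))
    (hker : ∀ x, algebraMap R k x = 0 ↔ π ∣ x)
    (hker' : ∀ x : S, algebraMap S k' x = 0 ↔ ϖ ∣ x)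
    (hunit : ∀ x : R, algebraMap R k x ≠ 0 → IsUnit x)
    {g : ℕ} {ε : Sˣ} (hπ : algebraMap R S π = ε * ϖ ^ (2 * g + 1)) {κ : Type} [Fintype κ]
    (A : Matrix κ κ R) (a : R) (h : ∃ x : κ → S, bilinEval A x x = algebraMap R S a) (m : ℕ) :
    ∃ x : κ → R, π ^ m ∣ bilinEval A x x - a := by
  obtain ⟨x, hx⟩ := h
  obtain ⟨u₀, z, hz, ht⟩ := exists_pow_dvd_of_bilinEval_add_eq_zero hodd hϖ hsurj hker hker' hπ m
    (q := (0 : Matrix Empty Empty R)) (fun x _ => Subsingleton.elim _ _) 0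
    (fromBlocks A 0 0 ((-a) • (1 : Matrix Unit Unit R))) (Sum.elim 0 1)
    (u := 0) (w := Sum.elim x 1)
    (by
      rw [bilinEval_fromBlocks, hx]
      simp [bilinEval_eq_sum])
    (by simp [dotProduct])
  obtain ⟨x₀, t, rfl⟩ : ∃ x₀ t, z = Sum.elim x₀ t :=
    ⟨z ∘ Sum.inl, z ∘ Sum.inr, (Sum.elim_comp_inl_inr z).symm⟩
  obtain ⟨t', ht'⟩ := hunit _ ht
  have ht1 : t () = t' := by rw [ht']; simp [dotProduct]
  rw [bilinEval_fromBlocks] at hz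
  have h1 : π ^ m ∣ bilinEval A x₀ x₀ - a * (t' : R) ^ 2 := by
    convert hz using 1
    simp [bilinEval_eq_sum, ht1]
    ring
  refine ⟨(↑t'⁻¹ : R) • x₀, ?_⟩
  rw [bilinEval_smul_smul]
  convert h1.mul_left ((↑t'⁻¹ : R) ^ 2) using 1
  have : (↑t'⁻¹ : R) * t' = 1 := Units.inv_mul t'
  linear_combination (a * (↑t'⁻¹ * t' + 1)) * this

end Descent

lemma bilinEval_map_matrix {A R S : Type} [CommRing A] [CommRing R] [CommRing S] [Algebra A R] [Algebra A S]
    [Algebra R S] [IsScalarTower A R S] {κ : Type} [Fintype κ] (M : Matrix κ κ A) (x y : κ → S) :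
    bilinEval (M.map (algebraMap A R)) x y = bilinEval M x y := by
  simp [bilinEval_eq_sum, ← IsScalarTower.algebraMap_apply]

section Dedekind

variable {A B : Type} [CommRing A] [CommRing B] [IsDedekindDomain A] [IsDedekindDomain B]
  [Algebra A B] [Module.Finite A B] [Module.IsTorsionFree A B]

lemma exists_liesOver_odd_ramificationIdx_odd_inertiaDeg
    (hodd : Odd (Module.finrank A B)) (p : Ideal A) [p.IsMaximal] :
    ∃ q : Ideal B, q.IsPrime ∧ q.LiesOver p ∧ Odd (q.ramificationIdx A) ∧ Odd (q.inertiaDeg A) := by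
  rw [← Ideal.sum_ramification_inertia_eq_finrank p B] at hodd
  by_contra! h
  refine Nat.not_even_iff_odd.2 hodd (Finset.even_sum _ fun q _ ↦ ?_)
  rw [Nat.even_mul]
  have := h q.1 q.2.1 q.2.2
  by_cases h1 : Odd (q.1.ramificationIdx A)
  · exact Or.inr (Nat.not_odd_iff_even.1 (this h1))
  · exact Or.inl (Nat.not_odd_iff_even.1 h1)

lemma exists_bilinEval_sub_mem_maximalIdeal_pow (hodd : Odd (Module.finrank A B))
    (p : Ideal A) [p.IsPrime] (hp : p ≠ ⊥) [Finite (A ⧸ p)]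
    {κ : Type} [Fintype κ] (M : Matrix κ κ A) (a : A)
    (h : ∃ x : κ → B, bilinEval M x x = algebraMap A B a) (m : ℕ) :
    ∃ x : κ → Localization.AtPrime p, bilinEval M x x - algebraMap A (Localization.AtPrime p) a ∈
      IsLocalRing.maximalIdeal (Localization.AtPrime p) ^ m := by
  have : p.IsMaximal := Ideal.IsPrime.isMaximal ‹_› hp
  obtain ⟨q, hq, hqp, he, hf⟩ := exists_liesOver_odd_ramificationIdx_odd_inertiaDeg hodd p
  have hq' : q ≠ ⊥ := Ideal.ne_bot_of_liesOver_of_ne_bot hp q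
  let := Localization.AtPrime.algebraOfLiesOver p q
  have hSp := IsLocalization.AtPrime.isDiscreteValuationRing_of_dedekind_domain A hp
    (Localization.AtPrime p)
  have hSq := IsLocalization.AtPrime.isDiscreteValuationRing_of_dedekind_domain B hq'
    (Localization.AtPrime q)
  rw [Ideal.inertiaDeg_eq p q] at hf
  obtain ⟨π, hπ⟩ := IsDiscreteValuationRing.exists_irreducible (Localization.AtPrime p)
  obtain ⟨ϖ, hϖ⟩ := IsDiscreteValuationRing.exists_irreducible (Localization.AtPrime q)
  have hinj : Function.Injective (algebraMap A (Localization.AtPrime q)) := by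
    rw [IsScalarTower.algebraMap_eq A B]
    exact (IsLocalization.injective _ q.primeCompl_le_nonZeroDivisors).comp
      (FaithfulSMul.algebraMap_injective A B)
  have hmap : Ideal.map (algebraMap A (Localization.AtPrime q)) p =
      Ideal.span {algebraMap (Localization.AtPrime p) (Localization.AtPrime q) π} := by
    rw [IsScalarTower.algebraMap_eq A (Localization.AtPrime p), ← Ideal.map_map,
      Localization.AtPrime.map_eq_maximalIdeal, hπ.maximalIdeal_eq, Ideal.map_span,
      Set.image_singleton]
  have hne : algebraMap (Localization.AtPrime p) (Localization.AtPrime q) π ≠ 0 := by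
    intro h0
    rw [h0, Ideal.span_singleton_eq_bot.2 rfl, Ideal.map_eq_bot_iff_of_injective hinj] at hmap
    exact hp hmap
  obtain ⟨n, hn⟩ := IsDiscreteValuationRing.associated_pow_irreducible hne hϖ
  have hlen : q.ramificationIdx A = n := by
    rw [Ideal.ramificationIdx_eq p q, hmap, Ideal.span_singleton_eq_span_singleton.2 hn,
      ← Ideal.span_singleton_pow, ← hϖ.maximalIdeal_eq, hSq.length_quotient_pow_maximalIdeal,
      ENat.toNat_natCast]
  obtain ⟨g, hg⟩ := he
  obtain ⟨ε, hε⟩ := hn.symm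
  obtain ⟨y, hy⟩ := h
  obtain ⟨x, hx⟩ := exists_pow_dvd_bilinEval_sub (k := p.ResidueField) (k' := q.ResidueField) hf
    (π := π) (ϖ := ϖ) hϖ.ne_zero IsLocalRing.residue_surjective
    (fun x ↦ by
      rw [← Ideal.mem_span_singleton, ← hπ.maximalIdeal_eq]
      exact IsLocalRing.residue_eq_zero_iff x)
    (fun x ↦ by
      rw [← Ideal.mem_span_singleton, ← hϖ.maximalIdeal_eq]
      exact IsLocalRing.residue_eq_zero_iff x)
    (fun x hx ↦ (IsLocalRing.residue_ne_zero_iff_isUnit x).1 hx)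
    (g := g) (ε := ε) (by rw [← hε, ← hlen, hg, mul_comm])
    (M.map (algebraMap A (Localization.AtPrime p))) (algebraMap A (Localization.AtPrime p) a)
    ⟨algebraMap B (Localization.AtPrime q) ∘ y, by
      rw [bilinEval_map_matrix, ← bilinEval_map, hy, ← IsScalarTower.algebraMap_apply,
        ← IsScalarTower.algebraMap_apply]⟩ m
  refine ⟨x, ?_⟩
  rwa [hπ.maximalIdeal_eq, Ideal.span_singleton_pow, Ideal.mem_span_singleton,
    ← bilinEval_map_matrix (R := Localization.AtPrime p)]

end Dedekind

section AdicCompletion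

open IsDedekindDomain HeightOneSpectrum

variable (A : Type) [CommRing A] [IsDedekindDomain A] (K : Type) [Field K] [Algebra A K]
  [IsFractionRing A K] (v : HeightOneSpectrum A)

lemma valued_algebraMap_adicCompletionIntegers (r : A) :
    Valued.v (algebraMap A (v.adicCompletionIntegers K) r : v.adicCompletion K) =
      v.intValuation r := by
  rw [algebraMap_adicCompletionIntegers_apply, valuedAdicCompletion_eq_valuation',
    valuation_of_algebraMap]

lemma mem_maximalIdeal_adicCompletionIntegers_iff (x : v.adicCompletionIntegers K) :
    x ∈ IsLocalRing.maximalIdeal (v.adicCompletionIntegers K) ↔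
      Valued.v (x : v.adicCompletion K) < 1 := by
  rw [IsLocalRing.mem_maximalIdeal, mem_nonunits_iff,
    adicCompletionIntegers.isUnit_iff_valued_eq_one]
  exact ⟨fun h ↦ lt_of_le_of_ne x.2 h, ne_of_lt⟩

lemma exists_algebraMap_sub_mem_maximalIdeal (x : v.adicCompletionIntegers K) :
    ∃ r : A, algebraMap A (v.adicCompletionIntegers K) r - x ∈
      IsLocalRing.maximalIdeal (v.adicCompletionIntegers K) := by
  have hopen : IsOpen {z : v.adicCompletion K | Valued.v (z - x) < 1} := by
    have := (Valued.isOpen_ball (v.adicCompletion K) 1).preimage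
      (continuous_sub_right (x : v.adicCompletion K))
    simpa [Set.preimage] using this
  obtain ⟨k, hk⟩ := (denseRange_algebraMap K v).exists_mem_open hopen ⟨x, by simp⟩
  rw [Set.mem_ofPred_eq] at hk
  have hk1 : Valued.v (algebraMap K (v.adicCompletion K) k) ≤ 1 := by
    rw [← sub_add_cancel (algebraMap K (v.adicCompletion K) k) x]
    exact (Valuation.map_add _ _ _).trans (max_le hk.le x.2)
  have hcoe (k : K) : Valued.v (algebraMap K (v.adicCompletion K) k) = v.valuation K k :=
    valuedAdicCompletion_eq_valuation' v k
  rw [hcoe] at hk1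
  obtain ⟨r, hr⟩ := exists_valuation_sub_lt_of_integer v hk1 1
  refine ⟨r, ?_⟩
  rw [mem_maximalIdeal_adicCompletionIntegers_iff]
  have : ((algebraMap A (v.adicCompletionIntegers K) r - x : v.adicCompletionIntegers K) :
      v.adicCompletion K) = algebraMap K (v.adicCompletion K) (algebraMap A K r - k) +
        (algebraMap K (v.adicCompletion K) k - x) := by
    rw [map_sub, sub_add_sub_cancel]
    rfl
  rw [this]
  refine Valuation.map_add_lt _ ?_ hk
  rw [hcoe]
  simpa using hr

lemma finite_residueField_adicCompletionIntegers [Finite (A ⧸ v.asIdeal)] :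
    Finite (IsLocalRing.ResidueField (v.adicCompletionIntegers K)) := by
  let f : A ⧸ v.asIdeal →+* IsLocalRing.ResidueField (v.adicCompletionIntegers K) :=
    Ideal.Quotient.lift v.asIdeal
      ((IsLocalRing.residue _).comp (algebraMap A (v.adicCompletionIntegers K))) fun r hr ↦ by
        rw [RingHom.comp_apply, IsLocalRing.residue_eq_zero_iff,
          mem_maximalIdeal_adicCompletionIntegers_iff, valued_algebraMap_adicCompletionIntegers]
        exact (v.intValuation_lt_one_iff_mem r).2 hr
  refine Finite.of_surjective f fun y ↦ ?_
  obtain ⟨x, rfl⟩ := IsLocalRing.residue_surjective y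
  obtain ⟨r, hr⟩ := exists_algebraMap_sub_mem_maximalIdeal A K v x
  refine ⟨Ideal.Quotient.mk _ r, ?_⟩
  rw [← IsLocalRing.residue_eq_zero_iff, map_sub, sub_eq_zero] at hr
  simpa [f] using hr

end AdicCompletion

section Localization

open IsDedekindDomain HeightOneSpectrum

variable (A : Type) [CommRing A] [IsDedekindDomain A] (K : Type) [Field K] [Algebra A K]
  [IsFractionRing A K] (v : HeightOneSpectrum A)

lemma isUnit_algebraMap_adicCompletionIntegers (s : v.asIdeal.primeCompl) :
    IsUnit (algebraMap A (v.adicCompletionIntegers K) s) := by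
  rw [adicCompletionIntegers.isUnit_iff_valued_eq_one, valued_algebraMap_adicCompletionIntegers]
  exact (v.intValuation_eq_one_iff_mem_primeCompl _).2 s.2

/-- The localization at a height one prime maps to the ring of integers of the completion. -/
noncomputable def localizationToAdicCompletionIntegers :
    Localization.AtPrime v.asIdeal →+* v.adicCompletionIntegers K :=
  IsLocalization.lift (M := v.asIdeal.primeCompl) (isUnit_algebraMap_adicCompletionIntegers A K v)

lemma localizationToAdicCompletionIntegers_algebraMap (r : A) :
    localizationToAdicCompletionIntegers A K v (algebraMap A _ r) =
      algebraMap A (v.adicCompletionIntegers K) r :=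
  IsLocalization.lift_eq _ r

lemma localizationToAdicCompletionIntegers_mem {m : ℕ} {x : Localization.AtPrime v.asIdeal}
    (hx : x ∈ IsLocalRing.maximalIdeal (Localization.AtPrime v.asIdeal) ^ m) :
    localizationToAdicCompletionIntegers A K v x ∈
      IsLocalRing.maximalIdeal (v.adicCompletionIntegers K) ^ m := by
  have h := Ideal.mem_map_of_mem (localizationToAdicCompletionIntegers A K v) hx
  rw [Ideal.map_pow] at h
  refine Ideal.pow_right_mono ?_ m h
  rw [← Localization.AtPrime.map_eq_maximalIdeal, Ideal.map_map, Ideal.map_le_iff_le_comap]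
  intro r hr
  rw [Ideal.mem_comap, RingHom.comp_apply, localizationToAdicCompletionIntegers_algebraMap,
    mem_maximalIdeal_adicCompletionIntegers_iff, valued_algebraMap_adicCompletionIntegers]
  exact (v.intValuation_lt_one_iff_mem r).2 hr

end Localization

section Compact

lemma exists_eq_zero_of_forall_mem_maximalIdeal_pow {R X : Type} [CommRing R] [IsDomain R]
    [IsLocalRing R] [IsNoetherianRing R] [TopologicalSpace R] [IsTopologicalRing R] [T2Space R]
    [CompactSpace R] [TopologicalSpace X] [CompactSpace X] (f : X → R) (hf : Continuous f)
    (h : ∀ m : ℕ, ∃ x, f x ∈ IsLocalRing.maximalIdeal R ^ m) : ∃ x, f x = 0 := by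
  have hcl (m : ℕ) : IsClosed (f ⁻¹' (IsLocalRing.maximalIdeal R ^ m : Ideal R)) :=
    (Ideal.isCompact_of_fg (IsNoetherian.noetherian _)).isClosed.preimage hf
  obtain ⟨x, hx⟩ := IsCompact.nonempty_iInter_of_sequence_nonempty_isCompact_isClosed
    (fun m : ℕ ↦ f ⁻¹' (IsLocalRing.maximalIdeal R ^ m : Ideal R))
    (fun m ↦ Set.preimage_mono (Ideal.pow_le_pow_right m.le_succ))
    h (hcl 0).isCompact hcl
  refine ⟨x, ?_⟩
  rw [← Ideal.mem_bot, ← Ideal.iInf_pow_eq_bot_of_isLocalRing _ (IsLocalRing.maximalIdeal.isMaximal R).ne_top,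
    Ideal.mem_iInf]
  exact fun m ↦ Set.mem_iInter.1 hx m

end Compact

section Places

open IsDedekindDomain HeightOneSpectrum NumberField

variable (K : Type) [Field K] [NumberField K] (v : HeightOneSpectrum (𝓞 K))

open scoped Valued in
lemma compactSpace_adicCompletionIntegers : CompactSpace (v.adicCompletionIntegers K) := by
  have : Finite (𝓞 K ⧸ v.asIdeal) := Ideal.finiteQuotientOfFreeOfNeBot _ v.ne_bot
  have h1 : IsDiscreteValuationRing 𝒪[v.adicCompletion K] :=
    inferInstanceAs (IsDiscreteValuationRing (v.adicCompletionIntegers K))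
  have h2 : Finite 𝓀[v.adicCompletion K] := finite_residueField_adicCompletionIntegers (𝓞 K) K v
  have h3 : CompleteSpace 𝒪[v.adicCompletion K] :=
    (Valued.isClosed_integer (v.adicCompletion K)).completeSpace_coe
  exact Valued.integer.compactSpace_iff_completeSpace_and_isDiscreteValuationRing_and_finite_residueField.2
    ⟨h3, h1, h2⟩

end Places

section QuadraticPolynomial

open MvPolynomial

lemma Finsupp.exists_single_add_single_of_degree_eq_two {ι : Type} {d : ι →₀ ℕ}
    (hd : d.degree = 2) : ∃ i j, d = Finsupp.single i 1 + Finsupp.single j 1 := by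
  classical
  have hcard : Multiset.card (Finsupp.toMultiset d) = 2 := (Finsupp.card_toMultiset d).trans hd
  rw [Multiset.card_eq_two] at hcard
  obtain ⟨i, j, hij⟩ := hcard
  refine ⟨i, j, Multiset.toFinsupp.symm.injective ?_⟩
  change Finsupp.toMultiset d = Finsupp.toMultiset _
  rw [hij, map_add, Finsupp.toMultiset_single, Finsupp.toMultiset_single, one_smul, one_smul]
  rfl

lemma exists_matrix_forall_aeval_eq_bilinEval {R κ : Type} [CommRing R] [Fintype κ]
    {Q : MvPolynomial κ R} (hQ : Q.IsHomogeneous 2) :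
    ∃ M : Matrix κ κ R, ∀ (S : Type) [CommRing S] [Algebra R S] (x : κ → S),
      aeval x Q = bilinEval M x x := by
  classical
  rw [Q.as_sum]
  refine Finset.sum_induction _ (fun P : MvPolynomial κ R ↦ ∃ M : Matrix κ κ R,
    ∀ (S : Type) [CommRing S] [Algebra R S] (x : κ → S), aeval x P = bilinEval M x x) ?_ ?_ ?_
  · rintro P P' ⟨M, hM⟩ ⟨M', hM'⟩
    refine ⟨M + M', fun S _ _ x ↦ ?_⟩
    rw [map_add, hM, hM']
    simp [bilinEval_eq_sum, add_mul, Finset.sum_add_distrib]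
  · exact ⟨0, fun S _ _ x ↦ by simp [bilinEval_eq_sum]⟩
  · intro d hd
    have hd2 : d.degree = 2 := by
      rw [← hQ (mem_support_iff.1 hd), Finsupp.degree_eq_weight_one, Pi.one_def]
    obtain ⟨i, j, hij⟩ := Finsupp.exists_single_add_single_of_degree_eq_two hd2
    refine ⟨Matrix.single i j (coeff d Q), fun S _ _ x ↦ ?_⟩
    rw [aeval_monomial, bilinEval_eq_sum, Finset.sum_eq_single i, Finset.sum_eq_single j]
    · rw [Matrix.single_apply_same, hij, Finsupp.prod_add_index' (by simp) (by simp [pow_add]),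
        Finsupp.prod_single_index (by simp), Finsupp.prod_single_index (by simp), pow_one, pow_one]
    · intro k _ hk
      simp [hk.symm]
    · simp
    · intro k _ hk
      simp [hk.symm]
    · simp

end QuadraticPolynomial

section Archimedean

lemma Polynomial.Monic.exists_isRoot_of_odd_natDegree {f : Polynomial ℝ} (hf : f.Monic)
    (hodd : Odd f.natDegree) : ∃ r, f.IsRoot r := by
  have h1 : Filter.Tendsto (fun x ↦ f.eval x) Filter.atTop Filter.atTop :=
    f.tendsto_atTop_of_leadingCoeff_nonneg (natDegree_pos_iff_degree_pos.1 hodd.pos)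
      (by simp [hf.leadingCoeff])
  have hdeg : (f.comp (-X)).natDegree = f.natDegree := by simp [natDegree_comp]
  have h2 : Filter.Tendsto (fun x ↦ (f.comp (-X)).eval x) Filter.atTop Filter.atBot :=
    tendsto_atBot_of_leadingCoeff_nonpos _
      (natDegree_pos_iff_degree_pos.1 (hdeg ▸ hodd.pos)) (by
        rw [leadingCoeff_comp (by simp), hf.leadingCoeff]
        simp [hodd.neg_one_pow])
  obtain ⟨b, hb⟩ := (h1.eventually_ge_atTop 0).exists
  obtain ⟨c, hc⟩ := (h2.eventually_le_atBot 0).exists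
  rw [eval_comp] at hc
  exact mem_range_of_exists_le_of_exists_ge f.continuous ⟨_, hc⟩ ⟨b, hb⟩

lemma exists_ringHom_real_comp_algebraMap {K L : Type} [Field K] [Field L] [Algebra K L]
    [FiniteDimensional K L] [Algebra.IsSeparable K L] (hodd : Odd (Module.finrank K L))
    (σ : K →+* ℝ) : ∃ τ : L →+* ℝ, τ.comp (algebraMap K L) = σ := by
  let := σ.toAlgebra
  let pb := Field.powerBasisOfFiniteOfSeparable K L
  obtain ⟨r, hr⟩ := Polynomial.Monic.exists_isRoot_of_odd_natDegree
    ((minpoly.monic pb.isIntegral_gen).map (algebraMap K ℝ)) (by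
      rwa [Polynomial.natDegree_map, pb.natDegree_minpoly, ← pb.finrank])
  refine ⟨(pb.lift r ?_ : L →ₐ[K] ℝ), ?_⟩
  · rwa [Polynomial.aeval_def, ← Polynomial.eval_map]
  · exact (pb.lift r _).comp_algebraMap

lemma exists_ringHom_complex_comp_algebraMap {K L : Type} [Field K] [Field L] [Algebra K L]
    [Algebra.IsAlgebraic K L] (σ : K →+* ℂ) :
    ∃ τ : L →+* ℂ, τ.comp (algebraMap K L) = σ := by
  let := σ.toAlgebra
  exact ⟨(IsAlgClosed.lift : L →ₐ[K] ℂ), AlgHom.comp_algebraMap _⟩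

open NumberField MvPolynomial in
lemma exists_eval₂_eq_of_comp_algebraMap_eq {K L E : Type} [Field K] [Field L] [Algebra K L]
    [Field E] {n : ℕ} (Q : MvPolynomial (Fin n) (𝓞 K)) (a : 𝓞 K)
    (hrep : ∃ x : Fin n → 𝓞 L, aeval x Q = algebraMap (𝓞 K) (𝓞 L) a)
    {σ : K →+* E} (h : ∃ τ : L →+* E, τ.comp (algebraMap K L) = σ) :
    ∃ x : Fin n → E,
      eval₂ (σ.comp (algebraMap (𝓞 K) K)) x Q = σ (algebraMap (𝓞 K) K a) := by
  obtain ⟨τ, rfl⟩ := h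
  obtain ⟨x, hx⟩ := hrep
  refine ⟨(τ.comp (algebraMap (𝓞 L) L)) ∘ x, ?_⟩
  have h2 : (τ.comp (algebraMap K L)).comp (algebraMap (𝓞 K) K) =
      (τ.comp (algebraMap (𝓞 L) L)).comp (algebraMap (𝓞 K) (𝓞 L)) := by
    rw [RingHom.comp_assoc, RingHom.comp_assoc, ← IsScalarTower.algebraMap_eq,
      ← IsScalarTower.algebraMap_eq]
  have h3 := congrArg (τ.comp (algebraMap (𝓞 L) L)) hx
  rw [aeval_def, hom_eval₂, ← h2, ← RingHom.comp_apply, ← h2] at h3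
  exact h3

end Archimedean

section Finite

open IsDedekindDomain HeightOneSpectrum NumberField MvPolynomial

lemma exists_aeval_adicCompletionIntegers_eq {K L : Type} [Field K] [NumberField K] [Field L]
    [NumberField L] [Algebra K L] (hodd : Odd (Module.finrank K L))
    {n : ℕ} {Q : MvPolynomial (Fin n) (𝓞 K)} (hQ : Q.IsHomogeneous 2) (a : 𝓞 K)
    (hrep : ∃ x : Fin n → 𝓞 L, aeval x Q = algebraMap (𝓞 K) (𝓞 L) a)
    (v : HeightOneSpectrum (𝓞 K)) :
    ∃ x : Fin n → v.adicCompletionIntegers K,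
      aeval x Q = algebraMap (𝓞 K) (v.adicCompletionIntegers K) a := by
  obtain ⟨M, hM⟩ := exists_matrix_forall_aeval_eq_bilinEval hQ
  simp only [hM] at hrep ⊢
  have : Finite (𝓞 K ⧸ v.asIdeal) := Ideal.finiteQuotientOfFreeOfNeBot _ v.ne_bot
  have hfin : Module.finrank (𝓞 K) (𝓞 L) = Module.finrank K L :=
    (IsFractionRing.finrank_eq (𝓞 K) K (𝓞 L) L).symm
  have := compactSpace_adicCompletionIntegers K v
  have hcont : Continuous fun x : Fin n → v.adicCompletionIntegers K ↦
      bilinEval M x x - algebraMap (𝓞 K) (v.adicCompletionIntegers K) a := by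
    simp only [bilinEval_eq_sum]
    fun_prop
  obtain ⟨x, hx⟩ := exists_eq_zero_of_forall_mem_maximalIdeal_pow _ hcont fun m ↦ by
    obtain ⟨x, hx⟩ := exists_bilinEval_sub_mem_maximalIdeal_pow (hfin ▸ hodd) v.asIdeal v.ne_bot
      M a hrep m
    refine ⟨localizationToAdicCompletionIntegers (𝓞 K) K v ∘ x, ?_⟩
    have h := localizationToAdicCompletionIntegers_mem (𝓞 K) K v hx
    simpa [bilinEval_eq_sum, localizationToAdicCompletionIntegers_algebraMap] using h
  exact ⟨x, sub_eq_zero.1 hx⟩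

end Finite

end

/-- If `L/K` is an odd-degree extension of number fields, `Q` a quadratic
form (homogeneous polynomial of degree 2) in `n` variables over `𝓞 K`, and `a ∈ 𝓞 K` is
represented by `Q` over `𝓞 L`, then `a` is locally represented by `Q` over `𝓞 K`:
it is represented over the valuation ring `𝓞_v` of every nonarchimedean completion `K_v`,
and over every archimedean completion of `K` (the real completions attached to embeddings
`K →+* ℝ` and the complex completions attached to embeddings `K →+* ℂ`). -/
theorem statement0
    (K L : Type) [Field K] [NumberField K] [Field L] [NumberField L]
    [Algebra K L] (hodd : Odd (Module.finrank K L))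
    (n : ℕ) (Q : MvPolynomial (Fin n) (𝓞 K)) (hQ : Q.IsHomogeneous 2)
    (a : 𝓞 K)
    (hrep : ∃ x : Fin n → 𝓞 L, aeval x Q = algebraMap (𝓞 K) (𝓞 L) a) :
    (∀ v : HeightOneSpectrum (𝓞 K),
      ∃ x : Fin n → v.adicCompletion K,
        (∀ i, x i ∈ v.adicCompletionIntegers K) ∧
        eval₂ ((algebraMap K (v.adicCompletion K)).comp (algebraMap (𝓞 K) K)) x Q
          = algebraMap K (v.adicCompletion K) (algebraMap (𝓞 K) K a)) ∧
    (∀ σ : K →+* ℝ,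
      ∃ x : Fin n → ℝ,
        eval₂ (σ.comp (algebraMap (𝓞 K) K)) x Q = σ (algebraMap (𝓞 K) K a)) ∧
    (∀ σ : K →+* ℂ,
      ∃ x : Fin n → ℂ,
        eval₂ (σ.comp (algebraMap (𝓞 K) K)) x Q = σ (algebraMap (𝓞 K) K a)) := by
  have : FiniteDimensional K L := Module.finite_of_finrank_pos hodd.pos
  refine ⟨fun v ↦ ?_, fun σ ↦ ?_, fun σ ↦ ?_⟩
  · obtain ⟨x, hx⟩ := exists_aeval_adicCompletionIntegers_eq hodd hQ a hrep v
    refine ⟨fun i ↦ x i, fun i ↦ (x i).2, ?_⟩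
    have h := congrArg (v.adicCompletionIntegers K).subtype hx
    rw [aeval_def, hom_eval₂] at h
    exact h
  · exact exists_eval₂_eq_of_comp_algebraMap_eq Q a hrep
      (exists_ringHom_real_comp_algebraMap hodd σ)
  · exact exists_eval₂_eq_of_comp_algebraMap_eq Q a hrep
      (exists_ringHom_complex_comp_algebraMap σ)
end

section
/- Let d be a positive integer, K a totally real number field, Q a positive definite quadratic form in n variables with coefficients in 𝓞_K, and a ∈ 𝓞_K. Then, inside a fixed algebraic closure of K, there exist only finitely many totally real fields L containing K with [L : K] = d such that a ∈ Q(𝓞_L) but a ∉ Q(𝓞_{L'}) for every intermediate field K ⊆ L' ⊊ L with L' a proper subfield of L. -/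
open NumberField MvPolynomial

open Matrix in
/-- A homogeneous quadratic polynomial is given by a matrix. -/
theorem MvPolynomial.exists_matrix_eval₂_of_isHomogeneous_two {R : Type*} [CommRing R] {n : ℕ}
    {Q : MvPolynomial (Fin n) R} (hQ : Q.IsHomogeneous 2) :
    ∃ M : Matrix (Fin n) (Fin n) R, ∀ {S : Type} [CommRing S] (f : R →+* S) (x : Fin n → S),
      eval₂ f x Q = x ⬝ᵥ (M.map f *ᵥ x) := by
  classical
  let P : MvPolynomial (Fin n) R → Prop := fun Q ↦
    ∃ M : Matrix (Fin n) (Fin n) R, ∀ {S : Type} [CommRing S] (f : R →+* S) (x : Fin n → S),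
      eval₂ f x Q = x ⬝ᵥ (M.map f *ᵥ x)
  change P Q
  rw [← Q.support_sum_monomial_coeff]
  refine Finset.sum_induction _ P ?_ ?_ ?_
  · rintro p q ⟨M, hM⟩ ⟨N, hN⟩
    refine ⟨M + N, fun f x ↦ ?_⟩
    rw [eval₂_add, hM, hN, Matrix.map_add _ (map_add f), add_mulVec, dotProduct_add]
  · exact ⟨0, fun f x ↦ by simp [Matrix.map_zero _ (map_zero f)]⟩
  · intro m hm
    have hdeg : m.degree = 2 := by
      have := hQ (mem_support_iff.mp hm)
      rwa [Pi.one_def, ← Finsupp.degree_eq_weight_one] at this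
    obtain ⟨i, hi⟩ : ∃ i, m i ≠ 0 := by
      by_contra! h
      have : m = 0 := Finsupp.ext h
      simp [this] at hdeg
    obtain ⟨m', rfl⟩ : ∃ m', m = Finsupp.single i 1 + m' :=
      ⟨m - Finsupp.single i 1, (add_tsub_cancel_of_le (by simpa [Nat.one_le_iff_ne_zero])).symm⟩
    have hdeg' : m'.degree = 1 := by
      rw [map_add, Finsupp.degree_single] at hdeg
      omega
    obtain ⟨j, rfl⟩ := Finsupp.range_single_one.superset hdeg'
    refine ⟨Matrix.single i j (coeff (Finsupp.single i 1 + Finsupp.single j 1) Q), fun f x ↦ ?_⟩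
    simp [eval₂_monomial, Finsupp.prod_add_index', pow_add, Matrix.map_single,
      Matrix.single_mulVec]
    rw [← Pi.single, dotProduct_single]
    ring

open Matrix in
theorem RingHom.map_dotProduct_mulVec {R S ι : Type*} [CommRing R] [CommRing S] [Fintype ι]
    (f : R →+* S) (M : Matrix ι ι R) (v w : ι → R) :
    f (v ⬝ᵥ (M *ᵥ w)) = (f ∘ v) ⬝ᵥ (M.map f *ᵥ (f ∘ w)) := by
  rw [RingHom.map_dotProduct]
  congr 1
  ext i
  exact RingHom.map_mulVec f M w i

open Matrix in
theorem Matrix.dotProduct_add_transpose_mulVec {S ι : Type*} [CommRing S] [Fintype ι]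
    (N : Matrix ι ι S) (v : ι → S) :
    v ⬝ᵥ ((N + Nᵀ) *ᵥ v) = 2 * (v ⬝ᵥ (N *ᵥ v)) := by
  rw [add_mulVec, dotProduct_add, mulVec_transpose, dotProduct_comm v (v ᵥ* N),
    ← dotProduct_mulVec, two_mul]

open Matrix in
/-- A quadratic form over a subring of `ℝ` which is positive on nonzero vectors extends to a
positive definite form over `ℝ`. -/
theorem Matrix.posDef_map_add_transpose {R : Type*} [CommRing R] [IsDomain R] {n : ℕ}
    (M : Matrix (Fin n) (Fin n) R) (f : R →+* ℝ) (hf : Function.Injective f)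
    (hpos : ∀ v : Fin n → R, v ≠ 0 → 0 < f (v ⬝ᵥ (M *ᵥ v))) :
    ((M + Mᵀ).map f).PosDef := by
  have hnonneg : ∀ x : Fin n → ℝ, 0 ≤ x ⬝ᵥ (M.map f *ᵥ x) := by
    have hdense : DenseRange (Pi.map fun (_ : Fin n) (q : ℚ) ↦ (q : ℝ)) :=
      DenseRange.piMap fun _ ↦ Rat.denseRange_cast
    intro x
    refine hdense.induction_on x (isClosed_le continuous_const (by fun_prop)) fun v ↦ ?_
    obtain ⟨b, hb⟩ := IsLocalization.exist_integer_multiples_of_finite (nonZeroDivisors ℤ) v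
    choose w hw using hb
    have hb0 : ((b : ℤ) : ℝ) ≠ 0 := by exact_mod_cast nonZeroDivisors.coe_ne_zero b
    have hw' : f ∘ (fun i ↦ (w i : R)) =
        ((b : ℤ) : ℝ) • (Pi.map (fun (_ : Fin n) (q : ℚ) ↦ (q : ℝ)) v) := by
      ext i
      have h := hw i
      simp only [algebraMap_int_eq, eq_intCast, zsmul_eq_mul] at h
      simp only [Function.comp_apply, map_intCast, Pi.smul_apply, Pi.map_apply, smul_eq_mul]
      exact_mod_cast congrArg (Rat.cast : ℚ → ℝ) h
    have h0 : 0 ≤ f ((fun i ↦ (w i : R)) ⬝ᵥ (M *ᵥ (fun i ↦ (w i : R)))) := by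
      by_cases hv : (fun i ↦ (w i : R)) = 0
      · simp [hv]
      · exact (hpos _ hv).le
    rw [RingHom.map_dotProduct_mulVec, hw', mulVec_smul, dotProduct_smul, smul_dotProduct,
      smul_smul, smul_eq_mul] at h0
    exact nonneg_of_mul_nonneg_right h0 (mul_self_pos.mpr hb0)
  have hG : (M + Mᵀ).map f = M.map f + (M.map f)ᵀ := by
    rw [Matrix.map_add _ (map_add f), transpose_map]
  have hpsd : ((M + Mᵀ).map f).PosSemidef := by
    refine .of_dotProduct_mulVec_nonneg ?_ fun x ↦ ?_
    · rw [hG, IsHermitian, conjTranspose_eq_transpose_of_trivial, transpose_add,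
        transpose_transpose, add_comm]
    · rw [star_trivial, hG, dotProduct_add_transpose_mulVec]
      exact mul_nonneg zero_le_two (hnonneg x)
  rw [hpsd.posDef_iff_det_ne_zero]
  intro hdet
  have hdet' : (M + Mᵀ).det = 0 := by
    apply hf
    rw [RingHom.map_det, map_zero]
    exact hdet
  obtain ⟨v, hv, hv0⟩ := exists_mulVec_eq_zero_iff.mpr hdet'
  have h := congrArg f (dotProduct_add_transpose_mulVec M v)
  rw [hv0, dotProduct_zero, map_zero, map_mul, map_ofNat] at h
  linarith [hpos v hv]

open Matrix in
/-- A positive definite real form bounds the coordinates of a vector. -/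
theorem Matrix.PosDef.exists_norm_sq_le {n : ℕ} {A : Matrix (Fin n) (Fin n) ℝ} (hA : A.PosDef) :
    ∃ c : ℝ, 0 < c ∧ ∀ x : Fin n → ℝ, c * ‖x‖ ^ 2 ≤ x ⬝ᵥ (A *ᵥ x) := by
  have hpos (x : Fin n → ℝ) (hx : x ≠ 0) : 0 < x ⬝ᵥ (A *ᵥ x) := by
    simpa using hA.dotProduct_mulVec_pos hx
  obtain ⟨c, hc, hmin⟩ : ∃ c : ℝ, 0 < c ∧
      ∀ x ∈ Metric.sphere (0 : Fin n → ℝ) 1, c ≤ x ⬝ᵥ (A *ᵥ x) := by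
    rcases (Metric.sphere (0 : Fin n → ℝ) 1).eq_empty_or_nonempty with h | h
    · exact ⟨1, one_pos, by simp [h]⟩
    · obtain ⟨y, hy, hmin⟩ := (isCompact_sphere (0 : Fin n → ℝ) 1).exists_isMinOn h
        (f := fun x ↦ x ⬝ᵥ (A *ᵥ x)) (by fun_prop)
      exact ⟨_, hpos y (ne_zero_of_mem_unit_sphere ⟨y, hy⟩), fun x hx ↦ hmin hx⟩
  refine ⟨c, hc, fun x ↦ ?_⟩
  rcases eq_or_ne x 0 with rfl | hx
  · simp
  have hx' : 0 < ‖x‖ := norm_pos_iff.mpr hx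
  have h := hmin (‖x‖⁻¹ • x) (by simp [norm_smul, hx'.ne'])
  rw [mulVec_smul, dotProduct_smul, smul_dotProduct, smul_smul, smul_eq_mul] at h
  calc c * ‖x‖ ^ 2 ≤ ‖x‖⁻¹ * ‖x‖⁻¹ * (x ⬝ᵥ (A *ᵥ x)) * ‖x‖ ^ 2 := by gcongr
    _ = x ⬝ᵥ (A *ᵥ x) := by field_simp

/-- The representations of a given element by a quadratic form which is positive on nonzero
vectors over a subring of `ℝ` are bounded. -/
theorem MvPolynomial.exists_abs_le_of_eval₂_eq {R : Type*} [CommRing R] [IsDomain R]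
    {n : ℕ} {Q : MvPolynomial (Fin n) R} (hQ : Q.IsHomogeneous 2) (f : R →+* ℝ)
    (hf : Function.Injective f) (hpos : ∀ v : Fin n → R, v ≠ 0 → 0 < f (eval v Q)) (a : ℝ) :
    ∃ B : ℝ, ∀ x : Fin n → ℝ, eval₂ f x Q = a → ∀ i, |x i| ≤ B := by
  obtain ⟨M, hM⟩ := exists_matrix_eval₂_of_isHomogeneous_two hQ
  have hpos' (v : Fin n → R) (hv : v ≠ 0) : 0 < f (v ⬝ᵥ (M.mulVec v)) := by
    have h := hpos v hv
    have hmap : f (eval v Q) = eval₂ f (f ∘ v) Q := by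
      rw [eval, coe_eval₂Hom, eval₂_comp_left, RingHom.comp_id]
    rw [hmap, hM] at h
    rwa [RingHom.map_dotProduct_mulVec]
  obtain ⟨c, hc, h⟩ := (M.posDef_map_add_transpose f hf hpos').exists_norm_sq_le
  refine ⟨√(2 * a / c), fun x hx i ↦ (norm_le_pi_norm x i).trans (Real.le_sqrt_of_sq_le ?_)⟩
  have h' := h x
  rw [Matrix.map_add _ (map_add f), Matrix.transpose_map,
    Matrix.dotProduct_add_transpose_mulVec, ← hM, hx] at h'
  rw [le_div_iff₀ hc]
  linarith

/-- In an extension of a number field, there are only finitely many algebraic integers contained in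
number fields of a fixed degree, all of whose conjugates are bounded by a fixed constant. -/
theorem NumberField.finite_isIntegral_of_norm_le_of_finrank_eq {K E : Type} [Field K]
    [NumberField K] [Field E] [Algebra K E] (D : ℕ) (B : ℝ) :
    {x : E | ∃ L : IntermediateField K E, ∃ _ : NumberField L, Module.finrank ℚ L = D ∧
      ∃ y : L, (y : E) = x ∧ IsIntegral ℤ y ∧ ∀ σ : L →+* ℂ, ‖σ y‖ ≤ B}.Finite := by
  classical
  have : CharZero E := charZero_of_injective_algebraMap (algebraMap K E).injective
  let C := Nat.ceil (max B 1 ^ D * D.choose (D / 2))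
  refine (Polynomial.bUnion_roots_finite (algebraMap ℤ E) D
    (Set.finite_Icc (-C : ℤ) C)).subset ?_
  rintro _ ⟨L, _, rfl, y, rfl, hy, hB⟩
  have h_map := minpoly.isIntegrallyClosed_eq_field_fractions' ℚ hy
  simp_rw [Set.mem_iUnion]
  refine ⟨minpoly ℤ y, ⟨?_, fun i ↦ ?_⟩, Polynomial.mem_rootSet.2 ⟨minpoly.ne_zero hy, ?_⟩⟩
  · rw [← (minpoly.monic hy).natDegree_map (algebraMap ℤ ℚ), ← h_map]
    exact minpoly.natDegree_le y
  · rw [Set.mem_Icc, ← abs_le, ← @Int.cast_le ℝ]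
    refine (Eq.trans_le ?_ <| Embeddings.coeff_bdd_of_norm_le hB i).trans (Nat.le_ceil _)
    rw [h_map, Polynomial.coeff_map, eq_intCast, Int.norm_cast_rat, Int.norm_eq_abs, Int.cast_abs]
  · have h := Polynomial.aeval_algebraMap_apply E y (minpoly ℤ y)
    rwa [minpoly.aeval, map_zero] at h

/-- Let `d` be a positive integer, `K` a totally real number field, `Q` a
positive definite quadratic form in `n` variables over `𝓞 K` and `a ∈ 𝓞 K`. Inside a fixed
algebraic closure of `K`, there are only finitely many totally real fields `L ⊇ K` with
`[L : K] = d` such that `a` is represented by `Q` over the ring of integers of `L` (elements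
of `L` integral over `ℤ`) but not over the ring of integers of any proper intermediate
subfield `K ⊆ L' ⊊ L`. -/
theorem statement2
    (d : ℕ) (hd : 0 < d)
    (K : Type) [Field K] [NumberField K]
    (hK : ∀ σ : K →+* ℂ, ∀ x : K, (σ x).im = 0)
    (n : ℕ) (Q : MvPolynomial (Fin n) (𝓞 K)) (hQ : Q.IsHomogeneous 2)
    (hpos : ∀ v : Fin n → 𝓞 K, v ≠ 0 →
      ∀ σ : K →+* ℝ, 0 < σ (algebraMap (𝓞 K) K (eval v Q)))
    (a : 𝓞 K) :
    {L : IntermediateField K (AlgebraicClosure K) |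
      (∀ σ : L →+* ℂ, ∀ x : L, (σ x).im = 0) ∧
      Module.finrank K L = d ∧
      (∃ x : Fin n → L, (∀ i, IsIntegral ℤ (x i)) ∧
        eval₂ ((algebraMap K L).comp (algebraMap (𝓞 K) K)) x Q
          = algebraMap K L (algebraMap (𝓞 K) K a)) ∧
      (∀ L' : IntermediateField K (AlgebraicClosure K), L' < L →
        ¬ ∃ x : Fin n → L', (∀ i, IsIntegral ℤ (x i)) ∧
          eval₂ ((algebraMap K L').comp (algebraMap (𝓞 K) K)) x Q
            = algebraMap K L' (algebraMap (𝓞 K) K a))}.Finite := by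
  have hB : ∃ B : ℝ, ∀ (τ : K →+* ℝ) (x : Fin n → ℝ),
      eval₂ (τ.comp (algebraMap (𝓞 K) K)) x Q = τ (algebraMap (𝓞 K) K a) → ∀ i, |x i| ≤ B := by
    have hfin : Finite (K →+* ℝ) := by
      refine Finite.of_injective (fun τ : K →+* ℝ ↦ (algebraMap ℝ ℂ).comp τ) fun τ τ' h ↦ ?_
      ext x
      exact (algebraMap ℝ ℂ).injective (RingHom.congr_fun h x)
    choose B hB using fun τ : K →+* ℝ ↦ exists_abs_le_of_eval₂_eq hQ
      (τ.comp (algebraMap (𝓞 K) K)) (τ.injective.comp RingOfIntegers.coe_injective)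
      (fun v hv ↦ hpos v hv τ) (τ (algebraMap (𝓞 K) K a))
    obtain ⟨C, hC⟩ := (Set.finite_range B).bddAbove
    exact ⟨C, fun τ x hx i ↦ (hB τ x hx i).trans (hC ⟨τ, rfl⟩)⟩
  obtain ⟨B, hB⟩ := hB
  have hfin := NumberField.finite_isIntegral_of_norm_le_of_finrank_eq (K := K)
    (E := AlgebraicClosure K) (Module.finrank ℚ K * d) B
  refine ((Set.Finite.pi' fun _ : Fin n ↦ hfin).image
    fun x ↦ IntermediateField.adjoin K (Set.range x)).subset ?_
  rintro L ⟨hreal, hdeg, ⟨x, hx, hrep⟩, hmin⟩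
  have : FiniteDimensional K L := Module.finite_of_finrank_pos (hdeg ▸ hd)
  have : FiniteDimensional ℚ L := Module.Finite.trans K L
  have hL : NumberField L := ⟨⟩
  refine ⟨fun i ↦ (x i : AlgebraicClosure K), fun i ↦ ⟨L, hL, ?_, x i, rfl, hx i, fun σ ↦ ?_⟩, ?_⟩
  · rw [← hdeg, Module.finrank_mul_finrank]
  · have hσ : ComplexEmbedding.IsReal σ := by
      rw [ComplexEmbedding.isReal_iff]
      ext y
      exact Complex.conj_eq_iff_im.mpr (hreal σ y)
    have h := congrArg hσ.embedding hrep
    rw [hom_eval₂] at h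
    rw [← hσ.coe_embedding_apply, Complex.norm_real]
    exact hB (hσ.embedding.comp (algebraMap K L)) _ h i
  · by_contra hne
    have hle : IntermediateField.adjoin K (Set.range fun i ↦ (x i : AlgebraicClosure K)) ≤ L := by
      rw [IntermediateField.adjoin_le_iff]
      rintro _ ⟨i, rfl⟩
      exact (x i).2
    refine hmin _ (lt_of_le_of_ne hle hne) ⟨fun i ↦ ⟨x i,
      IntermediateField.subset_adjoin K _ ⟨i, rfl⟩⟩, fun i ↦ ?_, ?_⟩
    · rw [← isIntegral_algebraMap_iff (B := AlgebraicClosure K) Subtype.val_injective]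
      exact (hx i).map (L.val.toRingHom.toIntAlgHom)
    · have h := congrArg (algebraMap L (AlgebraicClosure K)) hrep
      apply (algebraMap _ (AlgebraicClosure K)).injective
      rw [hom_eval₂] at h ⊢
      exact h
end

section
/- Let n and m be positive integers with n ≡ 28 (mod 32), m ≡ 5 (mod 8), and n < 4m. Then there exist no integers w, x, y, z with n = w² + x² + y² + m·z². -/
theorem Int.sq_emod_eight (a : ℤ) : a ^ 2 % 8 = 0 ∨ a ^ 2 % 8 = 1 ∨ a ^ 2 % 8 = 4 := by
  have h : a % 8 = 0 ∨ a % 8 = 1 ∨ a % 8 = 2 ∨ a % 8 = 3 ∨ a % 8 = 4 ∨ a % 8 = 5 ∨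
      a % 8 = 6 ∨ a % 8 = 7 := by omega
  rcases h with h | h | h | h | h | h | h | h <;> simp [pow_two, Int.mul_emod, h]

theorem Int.sum_three_sq_emod_eight_ne_seven (w x y : ℤ) :
    (w ^ 2 + x ^ 2 + y ^ 2) % 8 ≠ 7 := by
  have hw := Int.sq_emod_eight w
  have hx := Int.sq_emod_eight x
  have hy := Int.sq_emod_eight y
  omega

theorem Int.even_of_sq_emod_four {a : ℤ} (h : a ^ 2 % 4 = 0) : Even a := by
  have h' : Even (a ^ 2) := Int.even_iff.mpr (by omega)
  exact (Int.even_pow.mp h').1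

theorem Int.sum_three_sq_emod_thirtytwo_ne (w x y : ℤ) :
    (w ^ 2 + x ^ 2 + y ^ 2) % 32 ≠ 28 := by
  intro h
  have hw := Int.sq_emod_eight w
  have hx := Int.sq_emod_eight x
  have hy := Int.sq_emod_eight y
  obtain ⟨a, rfl⟩ := Int.even_of_sq_emod_four (a := w) (by omega)
  obtain ⟨b, rfl⟩ := Int.even_of_sq_emod_four (a := x) (by omega)
  obtain ⟨c, rfl⟩ := Int.even_of_sq_emod_four (a := y) (by omega)
  have key : (a + a) ^ 2 + (b + b) ^ 2 + (c + c) ^ 2 = 4 * (a ^ 2 + b ^ 2 + c ^ 2) := by ring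
  have := Int.sum_three_sq_emod_eight_ne_seven a b c
  omega

/-- If `n, m` are positive integers with `n ≡ 28 (mod 32)`,
`m ≡ 5 (mod 8)` and `n < 4m`, then `n` is not of the form `w² + x² + y² + m z²`
with `w, x, y, z ∈ ℤ`. -/
theorem statement5 (n m : ℤ) (hn : 0 < n) (hm : 0 < m)
    (h1 : n % 32 = 28) (h2 : m % 8 = 5) (h3 : n < 4 * m) :
    ¬ ∃ w x y z : ℤ, n = w ^ 2 + x ^ 2 + y ^ 2 + m * z ^ 2 := by
  rintro ⟨w, x, y, z, h⟩
  have hz : z ^ 2 < 2 ^ 2 := by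
    nlinarith [sq_nonneg w, sq_nonneg x, sq_nonneg y]
  obtain ⟨hl, hu⟩ := abs_lt_of_sq_lt_sq' hz (by norm_num)
  have h7 := Int.sum_three_sq_emod_eight_ne_seven w x y
  have h28 := Int.sum_three_sq_emod_thirtytwo_ne w x y
  obtain rfl | rfl | rfl : z = -1 ∨ z = 0 ∨ z = 1 := by omega
  all_goals
    norm_num at h
    omega
end
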